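/- If a bi-infinite binary word ω ∈ {0,1}^ℤ is aperiodic (not ultimately periodic), and Q is the palindrome with φ(C(m,n)) = 0·Q·2 for a Christoffel word C(m,n) with m even, then the image of ω under the morphism 0 ↦ Q20, 1 ↦ Q02 is a bi-infinite ternary word whose abelian complexity equals 3 for every length n ≥ 1 at which it is non-trivial, and is at most 3 for all n ≥ 1. -/

import Mathlib

/-- Two words are conjugate (cyclic rotations of each other). -/
def Conj {α : Type*} (w w' : List α) : Prop := ∃ x y : List α, w = x ++ y ∧ w' = y ++ x

/-- `u` is a factor of the circular word `[w]`. -/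
def CFactor {α : Type*} (u w : List α) : Prop := ∃ w' : List α, Conj w w' ∧ u <:+: w'

/-- A (linear) word is balanced. -/
def WordIsBalanced {α : Type*} [DecidableEq α] (w : List α) : Prop :=
  ∀ u v : List α, u <:+: w → v <:+: w → u.length = v.length →
    ∀ a : α, ((u.count a : ℤ) - v.count a) ∈ ({-1, 0, 1} : Set ℤ)

/-- A circular word is balanced. -/
def CircBalanced {α : Type*} [DecidableEq α] (w : List α) : Prop :=
  ∀ u v : List α, CFactor u w → CFactor v w → u.length = v.length →
    ∀ a : α, ((u.count a : ℤ) - v.count a) ∈ ({-1, 0, 1} : Set ℤ)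

/-- The n-spectrum of a circular word: Parikh vectors of its length-n factors. -/
def circSpec {α : Type*} [DecidableEq α] (n : ℕ) (w : List α) : Set (α → ℕ) :=
  {p | ∃ u : List α, CFactor u w ∧ u.length = n ∧ (fun a => u.count a) = p}

/-- Abelian complexity of a circular word. -/
noncomputable def circAb {α : Type*} [DecidableEq α] (n : ℕ) (w : List α) : ℕ :=
  (circSpec n w).ncard

/-- A word is primitive if it is not a proper power. -/
def Primitive {α : Type*} (w : List α) : Prop :=
  ∀ (u : List α) (q : ℕ), 2 ≤ q → w ≠ (List.replicate q u).flatten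

/-- The lower Christoffel word `C(k, M-k)` of length `M` with `k` zeros. -/
def christoffel (k M : ℕ) : List (Fin 2) :=
  (List.range M).map (fun i => if i * (M - k) / M < (i + 1) * (M - k) / M then 1 else 0)

/-- Auxiliary scan for `phi`: the Boolean records whether the next occurrence
of `0` is odd-numbered. -/
def phiAux : Bool → List (Fin 2) → List (Fin 3)
  | _, [] => []
  | b, a :: t =>
    if a = 0 then (if b then (0 : Fin 3) else 1) :: phiAux (!b) t
    else (2 : Fin 3) :: phiAux b t

/-- `phi` replaces each `1` by `2` and each even-numbered occurrence of `0` by `1`. -/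
def phi (w : List (Fin 2)) : List (Fin 3) := phiAux true w

/-- A bi-infinite word is ultimately periodic. -/
def UltimatelyPeriodic {α : Type*} (W : ℤ → α) : Prop :=
  ∃ p : ℕ, 1 ≤ p ∧ ∃ J : ℤ, ∀ i : ℤ, J ≤ i → W (i + p) = W i

/-- The length-`n` factor of a bi-infinite word starting at position `i`. -/
def biFactor {α : Type*} (W : ℤ → α) (n : ℕ) (i : ℤ) : List α :=
  (List.range n).map (fun t => W (i + t))

/-- Abelian complexity of a bi-infinite word: number of Parikh vectors of
its length-`n` factors. -/
noncomputable def biAb {α : Type*} [DecidableEq α] (W : ℤ → α) (n : ℕ) : ℕ :=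
  Set.ncard {p : α → ℕ | ∃ i : ℤ, (fun a => (biFactor W n i).count a) = p}

/-- The image of a bi-infinite binary word under the substitution sending each
letter `a` to the block `B a`, all blocks having length `L`. -/
def biImage (W : ℤ → Fin 2) (B : Fin 2 → List (Fin 3)) (L : ℕ) : ℤ → Fin 3 :=
  fun i => (B (W (Int.fdiv i L))).getD (Int.fmod i L).toNat 0

/-- The number of letters `2` in a prefix of the image word, extended to all integer positions;
position `0` is the cut inside the last pair of the block indexed by `-1`. -/
def cutHeight (ω : ℤ → Fin 2) (n M j : ℤ) : ℤ :=
  j * n / M - if M ∣ j then ((ω (j / M - 1)).val : ℤ) else 0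

theorem phiAux_getElem? (b : Bool) (w : List (Fin 2)) (i : ℕ) :
    (phiAux b w)[i]? = (w[i]?).map (fun a => if a = 0 then
      (if ((w.take i).count 0 + (if b then 0 else 1)) % 2 = 0 then (0 : Fin 3) else 1) else 2) := by
  induction w generalizing b i with
  | nil => simp [phiAux]
  | cons a t ih =>
    cases i with
    | zero => cases b <;> by_cases h : a = 0 <;> simp [phiAux, h]
    | succ i =>
      by_cases h : a = 0
      · subst h
        simp only [phiAux, if_true, List.getElem?_cons_succ, ih, List.take_succ_cons,
          List.count_cons_self]
        congr 1
        funext a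
        have : ((t.take i).count 0 + (if (!b) = true then 0 else 1)) % 2 = 0 ↔
            ((t.take i).count 0 + 1 + (if b = true then 0 else 1)) % 2 = 0 := by
          cases b <;> simp; omega
        simp only [this]
      · simp only [phiAux, if_neg h, List.getElem?_cons_succ, ih, List.take_succ_cons,
          List.count_cons_of_ne h]

theorem christoffel_getElem? (m n i : ℕ) (hi : i < m + n) :
    (christoffel m (m + n))[i]? =
      some (if i * n / (m + n) < (i + 1) * n / (m + n) then 1 else 0) := by
  simp [christoffel, hi]

theorem succ_mul_div_le (n M i : ℕ) (hn : n ≤ M) (hM : 0 < M) :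
    i * n / M ≤ (i + 1) * n / M ∧ (i + 1) * n / M ≤ i * n / M + 1 := by
  refine ⟨Nat.div_le_div_right (by nlinarith), ?_⟩
  rw [← Nat.add_div_right _ hM]
  exact Nat.div_le_div_right (by nlinarith)

theorem count_take_christoffel (m n i : ℕ) (hm : 0 < m) (hi : i ≤ m + n) :
    ((christoffel m (m + n)).take i).count 0 + i * n / (m + n) = i := by
  induction i with
  | zero => simp
  | succ i ih =>
    have h1 := ih (by omega)
    have h2 := succ_mul_div_le n (m + n) i (by omega) (by omega)
    rw [List.take_add_one, christoffel_getElem? m n i (by omega), List.count_append]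
    split_ifs with h <;> simp <;> omega

theorem phi_christoffel_getElem? (m n i : ℕ) (hm : 0 < m) (hi : i < m + n) :
    (phi (christoffel m (m + n)))[i]? =
      some (if i * n / (m + n) < (i + 1) * n / (m + n) then 2 else
        if (i - i * n / (m + n)) % 2 = 0 then 0 else 1) := by
  have h := count_take_christoffel m n i hm hi.le
  have h' : ((christoffel m (m + n)).take i).count 0 = i - i * n / (m + n) := by omega
  rw [phi, phiAux_getElem?, christoffel_getElem? m n i hi, h']
  split_ifs <;> simp_all

theorem length_phiAux (b : Bool) (w : List (Fin 2)) : (phiAux b w).length = w.length := by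
  induction w generalizing b with
  | nil => rfl
  | cons a t ih => by_cases h : a = 0 <;> simp [phiAux, h, ih]

theorem exists_eventually_eq_of_add_le (v : ℤ → ℕ) (q : ℕ) (h : ∀ t, v (t + q) ≤ v t) :
    ∃ J : ℤ, ∀ i, J ≤ i → v (i + q) = v i := by
  let F : ℤ → ℕ := fun T => ∑ u ∈ Finset.range q, v (T + u)
  have hF (T : ℤ) : F (T + 1) + v T = F T + v (T + q) := by
    have h1 := Finset.sum_range_succ (fun u : ℕ => v (T + u)) q
    have h2 := Finset.sum_range_succ' (fun u : ℕ => v (T + u)) q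
    simp only [F]
    have h3 : ∀ u : ℕ, v (T + 1 + u) = v (T + (u + 1 : ℕ)) := fun u => by
      congr 1; push_cast; ring
    simp only [h3]
    rw [← h1, h2]; simp
  obtain ⟨T, hT⟩ : ∃ T, ∀ T', F T ≤ F T' :=
    ⟨Function.argmin F, fun T' => Function.argmin_le F T'⟩
  have hanti : Antitone F := antitone_int_of_succ_le fun T => by
    have := hF T; have := h T; omega
  refine ⟨T, fun i hi => ?_⟩
  have h1 := hanti hi
  have h2 := hT (i + 1)
  have := hF i; have := h i; omega

theorem exists_zero_one_of_not_ultimatelyPeriodic (ω : ℤ → Fin 2) (h : ¬ UltimatelyPeriodic ω)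
    (q : ℕ) (hq : 1 ≤ q) :
    (∃ t, (ω t).val = 0 ∧ (ω (t + q)).val = 1) ∧ (∃ t, (ω t).val = 1 ∧ (ω (t + q)).val = 0) := by
  constructor
  · by_contra! hc
    obtain ⟨J, hJ⟩ := exists_eventually_eq_of_add_le (fun t => (ω t).val) q fun t => by
      have := hc t; have := (ω t).isLt; have := (ω (t + q)).isLt; omega
    exact h ⟨q, hq, J, fun i hi => Fin.ext (hJ i hi)⟩
  · by_contra! hc
    obtain ⟨J, hJ⟩ := exists_eventually_eq_of_add_le (fun t => 1 - (ω t).val) q fun t => by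
      have := hc t; have := (ω t).isLt; have := (ω (t + q)).isLt; omega
    refine h ⟨q, hq, J, fun i hi => Fin.ext ?_⟩
    have := hJ i hi; have := (ω i).isLt; have := (ω (i + q)).isLt
    omega

theorem count_biFactor_succ (W : ℤ → Fin 3) (k : ℕ) (i : ℤ) (a : Fin 3) :
    (biFactor W (k + 1) i).count a = (biFactor W k i).count a + if W (i + k) = a then 1 else 0 := by
  simp [biFactor, List.range_succ, List.count_cons]

/-- A word whose letters are read off from the height function `S`: an increment is the letter `2`,
and otherwise the letter is the parity of `j - S j`. -/
def CodedBy (W : ℤ → Fin 3) (S : ℤ → ℤ) : Prop :=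
  ∀ i, (W i = 2 ∧ S (i + 2) = S (i + 1) + 1) ∨
    (S (i + 2) = S (i + 1) ∧ ((W i = 0 ∧ (i + 1 - S (i + 1)) % 2 = 0) ∨
      (W i = 1 ∧ (i + 1 - S (i + 1)) % 2 = 1)))

theorem CodedBy.count_biFactor {W : ℤ → Fin 3} {S : ℤ → ℤ} (h : CodedBy W S) (k : ℕ) (i : ℤ) :
    ((biFactor W k i).count 0 : ℤ) =
      (i + 1 + k - S (i + 1 + k) + 1) / 2 - (i + 1 - S (i + 1) + 1) / 2 ∧
    ((biFactor W k i).count 1 : ℤ) =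
      (i + 1 + k - S (i + 1 + k)) / 2 - (i + 1 - S (i + 1)) / 2 ∧
    ((biFactor W k i).count 2 : ℤ) = S (i + 1 + k) - S (i + 1) := by
  induction k with
  | zero => simp [biFactor]
  | succ k ih =>
    simp only [count_biFactor_succ]
    have e1 : i + 1 + ((k + 1 : ℕ) : ℤ) = i + k + 2 := by push_cast; ring
    have e2 : i + 1 + (k : ℤ) = i + k + 1 := by ring
    rw [e1]
    rw [e2] at ih
    obtain ⟨h0, h1, h2⟩ := ih
    rcases h (i + k) with ⟨hW, hS⟩ | ⟨hS, ⟨hW, hp⟩ | ⟨hW, hp⟩⟩ <;> rw [hW, hS] <;>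
      simp only [Nat.cast_add, h0, h1, h2] <;> simp <;> omega

theorem ncard_range_eq_three {β : Type*} (v : ℤ → β) (i₁ i₂ i₃ : ℤ) (h₁₂ : v i₁ ≠ v i₂)
    (h₁₃ : v i₁ ≠ v i₃) (h₂₃ : v i₂ ≠ v i₃)
    (h : ∀ i, v i = v i₁ ∨ v i = v i₂ ∨ v i = v i₃) :
    Set.ncard {p | ∃ i : ℤ, v i = p} = 3 := by
  have : {p | ∃ i : ℤ, v i = p} = {v i₁, v i₂, v i₃} := by
    ext p
    constructor
    · rintro ⟨i, rfl⟩
      exact h i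
    · rintro (rfl | rfl | rfl) <;> exact ⟨_, rfl⟩
  rw [this]
  exact Set.ncard_eq_three.2 ⟨_, _, _, h₁₂, h₁₃, h₂₃, rfl⟩

/-- If the increments of `j - S j` over a window of length `k` fall into three classes, determined by
the increment and, for odd increments, by the parity at the left end, then the abelian complexity
is three. -/
theorem CodedBy.biAb_eq_three {W : ℤ → Fin 3} {S : ℤ → ℤ} (hW : CodedBy W S) (k : ℕ)
    (d d₀ d₁ : ℤ) (hd : d % 2 = 0) (hd₀ : d₀ % 2 = 1) (hd₁ : d₁ % 2 = 1)
    (h : ∀ j, S (j + k) - S j = k - d ∨ (S (j + k) - S j = k - d₀ ∧ (j - S j) % 2 = 0) ∨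
      (S (j + k) - S j = k - d₁ ∧ (j - S j) % 2 = 1))
    (he : ∃ j, S (j + k) - S j = k - d)
    (he₀ : ∃ j, S (j + k) - S j = k - d₀ ∧ (j - S j) % 2 = 0)
    (he₁ : ∃ j, S (j + k) - S j = k - d₁ ∧ (j - S j) % 2 = 1) : biAb W k = 3 := by
  obtain ⟨j, hj⟩ := he
  obtain ⟨j₀, hj₀⟩ := he₀
  obtain ⟨j₁, hj₁⟩ := he₁
  have hc (i : ℤ) := hW.count_biFactor k (i - 1)
  simp only [sub_add_cancel] at hc
  have hA (i : ℤ) (hi : S (i + k) - S i = k - d) :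
      (fun a => (biFactor W k (i - 1)).count a) = fun a => (biFactor W k (j - 1)).count a := by
    have := hc i; have := hc j
    funext a; fin_cases a <;> simp <;> omega
  have hB (i : ℤ) (hi : S (i + k) - S i = k - d₀ ∧ (i - S i) % 2 = 0) :
      (fun a => (biFactor W k (i - 1)).count a) = fun a => (biFactor W k (j₀ - 1)).count a := by
    have := hc i; have := hc j₀
    funext a; fin_cases a <;> simp <;> omega
  have hC (i : ℤ) (hi : S (i + k) - S i = k - d₁ ∧ (i - S i) % 2 = 1) :
      (fun a => (biFactor W k (i - 1)).count a) = fun a => (biFactor W k (j₁ - 1)).count a := by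
    have := hc i; have := hc j₁
    funext a; fin_cases a <;> simp <;> omega
  refine ncard_range_eq_three (fun i => fun a => (biFactor W k i).count a) (j - 1) (j₀ - 1) (j₁ - 1)
    ?_ ?_ ?_ ?_
  · intro hh
    have := congrFun hh 2; have := hc j; have := hc j₀
    omega
  · intro hh
    have := congrFun hh 2; have := hc j; have := hc j₁
    omega
  · intro hh
    have := congrFun hh 0; have := congrFun hh 1; have := hc j₀; have := hc j₁
    omega
  · intro i
    rw [show i = i + 1 - 1 by ring]
    rcases h (i + 1) with h | h | h
    · exact Or.inl (hA _ h)
    · exact Or.inr (Or.inl (hB _ h))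
    · exact Or.inr (Or.inr (hC _ h))

theorem ediv_emod_of_eq {x M a s : ℤ} (h : x = M * a + s) (h0 : 0 ≤ s) (h1 : s < M) :
    x / M = a ∧ x % M = s :=
  (Int.ediv_emod_unique (by omega)).2 ⟨by rw [h]; ring, h0, h1⟩

theorem cutHeight_of_not_dvd (ω : ℤ → Fin 2) {n M j : ℤ} (h : ¬ M ∣ j) :
    cutHeight ω n M j = j * n / M := by
  simp [cutHeight, h]

theorem cutHeight_mul (ω : ℤ → Fin 2) {n M : ℤ} (hM : 0 < M) (t : ℤ) :
    cutHeight ω n M (M * t) = t * n - (ω (t - 1)).val := by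
  have h1 : M * t * n / M = t * n := by rw [mul_assoc, Int.mul_ediv_cancel_left _ hM.ne']
  have h2 : M * t / M = t := Int.mul_ediv_cancel_left _ hM.ne'
  simp [cutHeight, h1, h2]

theorem length_of_phi_christoffel {m n : ℕ} {Q : List (Fin 3)}
    (hQ : phi (christoffel m (m + n)) = 0 :: (Q ++ [2])) : Q.length + 2 = m + n := by
  have := congrArg List.length hQ
  rw [phi, length_phiAux] at this
  simp [christoffel] at this
  omega

theorem getElem?_of_phi_christoffel {m n : ℕ} (hm : 0 < m) {Q : List (Fin 3)}
    (hQ : phi (christoffel m (m + n)) = 0 :: (Q ++ [2])) {r : ℕ} (hr : r + 2 < m + n) :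
    Q[r]? = some (if (r + 1) * n / (m + n) < (r + 2) * n / (m + n) then 2 else
        if (r + 1 - (r + 1) * n / (m + n)) % 2 = 0 then 0 else 1) := by
  have hlen := length_of_phi_christoffel hQ
  have := phi_christoffel_getElem? m n (r + 1) hm (by omega)
  rw [hQ, List.getElem?_cons_succ, List.getElem?_append_left (by omega)] at this
  exact this

theorem codedBy_biImage (ω : ℤ → Fin 2) (m n : ℕ) (hm : 0 < m) (hn : 0 < n) (hme : Even m)
    (Q : List (Fin 3)) (hQ : phi (christoffel m (m + n)) = 0 :: (Q ++ [2])) :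
    CodedBy (biImage ω (fun a => if a = 0 then Q ++ [2, 0] else Q ++ [0, 2]) (m + n))
      (cutHeight ω n (m + n)) := by
  have hlen := length_of_phi_christoffel hQ
  intro i
  obtain ⟨M, hM⟩ : ∃ M : ℕ, M = m + n := ⟨_, rfl⟩
  have hM' : (m + n : ℤ) = M := by omega
  have hdvd (t s : ℤ) (h0 : 0 < s) (h1 : s < M) : ¬ (M : ℤ) ∣ M * t + s := fun h => by
    have h2 := (Int.dvd_iff_emod_eq_zero).1 ((Int.dvd_add_right (Dvd.intro _ rfl)).1 h)
    rw [Int.emod_eq_of_lt h0.le h1] at h2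
    omega
  have hdiv (t : ℤ) (s : ℕ) : (M * t + s) * n / (M : ℤ) = t * n + (s * n / M : ℕ) := by
    rw [show (M * t + s) * n = M * (t * n) + (s : ℤ) * n by ring,
      Int.mul_add_ediv_left _ _ (by omega)]
    push_cast; rfl
  have hr : ∃ (t : ℤ) (r : ℕ), i = M * t + r ∧ r < M := by
    refine ⟨i / M, (i % M).toNat, ?_, ?_⟩
    · rw [Int.toNat_of_nonneg (Int.emod_nonneg _ (by omega))]
      exact (Int.mul_ediv_add_emod _ _).symm
    · have := Int.emod_lt_of_pos i (show (0 : ℤ) < M by omega)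
      have := Int.emod_nonneg i (show (M : ℤ) ≠ 0 by omega)
      omega
  obtain ⟨t, r, hi, hrM⟩ := hr
  obtain ⟨h1, h2⟩ := ediv_emod_of_eq hi (by omega) (by omega)
  have hmt : ((m : ℤ) * t) % 2 = 0 := by
    obtain ⟨c, rfl⟩ := hme
    push_cast
    rw [← two_mul, mul_assoc, Int.mul_emod_right]
  have hMt : (M : ℤ) * t = m * t + t * n := by rw [← hM']; ring
  have himg : biImage ω (fun a => if a = 0 then Q ++ [2, 0] else Q ++ [0, 2]) (m + n) i =
      (if ω t = 0 then Q ++ [2, 0] else Q ++ [0, 2]).getD r 0 := by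
    simp only [biImage]
    rw [← hM, Int.fdiv_eq_ediv_of_nonneg _ (by omega),
      Int.fmod_eq_emod_of_nonneg _ (by omega), h1, h2, Int.toNat_natCast]
  rw [himg, hM']
  have hω := (ω t).isLt
  have hm2 : m % 2 = 0 := Nat.even_iff.1 hme
  have hcut : cutHeight ω n M (M * (t + 1)) = t * n + n - (ω t).val := by
    rw [cutHeight_mul ω (by omega), add_sub_cancel_right]; ring
  have hval : ω t = 0 ↔ (ω t).val = 0 := Fin.ext_iff
  have hin (s : ℕ) (h0 : 0 < s) (h1 : s < M) :
      cutHeight ω n M (M * t + s) = t * n + (s * n / M : ℕ) := by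
    rw [cutHeight_of_not_dvd ω (hdvd t s (by omega) (by omega)), hdiv]
  rcases (by omega : r + 2 < M ∨ r + 2 = M ∨ r + 1 = M) with hc | hc | hc
  · have hQr := getElem?_of_phi_christoffel hm hQ (hM ▸ hc)
    rw [← hM] at hQr
    have hS1 := hin (r + 1) (by omega) (by omega)
    have hS2 := hin (r + 2) (by omega) (by omega)
    rw [show (M * t + (r + 1 : ℕ) : ℤ) = i + 1 by rw [hi]; push_cast; ring] at hS1
    rw [show (M * t + (r + 2 : ℕ) : ℤ) = i + 2 by rw [hi]; push_cast; ring] at hS2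
    have hB : (if ω t = 0 then Q ++ [2, 0] else Q ++ [0, 2]).getD r 0 = Q[r]?.getD 0 := by
      split_ifs <;> rw [List.getD_eq_getElem?_getD, List.getElem?_append_left (by omega)]
    have hstep : (r + 1) * n / M ≤ (r + 2) * n / M ∧ (r + 2) * n / M ≤ (r + 1) * n / M + 1 :=
      succ_mul_div_le n M (r + 1) (by omega) (by omega)
    have hle : (r + 1) * n / M ≤ r + 1 :=
      Nat.div_le_of_le_mul (by rw [mul_comm M]; exact Nat.mul_le_mul_left _ (by omega))
    rw [hB, hQr, hS1, hS2]
    simp only [Option.getD_some]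
    split_ifs with h3 h4
    · exact Or.inl ⟨rfl, by omega⟩
    · exact Or.inr ⟨by omega, Or.inl ⟨rfl, by omega⟩⟩
    · exact Or.inr ⟨by omega, Or.inr ⟨rfl, by omega⟩⟩
  · have hS1 := hin (r + 1) (by omega) (by omega)
    rw [show (M * t + (r + 1 : ℕ) : ℤ) = i + 1 by rw [hi]; push_cast; ring] at hS1
    have hfl : (r + 1) * n / M = n - 1 := by
      obtain ⟨n, rfl⟩ : ∃ c, n = c + 1 := ⟨n - 1, by omega⟩
      refine Nat.div_eq_of_lt_le ?_ ?_
      · rw [← hc]; simp only [Nat.add_sub_cancel]; nlinarith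
      · rw [← hc]; simp only [Nat.add_sub_cancel]; nlinarith
    rw [show (M * (t + 1) : ℤ) = i + 2 by rw [hi, ← hc]; push_cast; ring] at hcut
    rw [hS1, hcut, hfl]
    have hQl : Q.length = r := by omega
    split_ifs with h3
    · rw [hval] at h3
      exact Or.inl ⟨by simp [← hQl, List.getD_eq_getElem?_getD], by omega⟩
    · rw [hval] at h3
      exact Or.inr ⟨by omega, Or.inl ⟨by simp [← hQl, List.getD_eq_getElem?_getD], by omega⟩⟩
  · have hfl : 1 * n / M = 0 := Nat.div_eq_of_lt (by omega)
    have hS2 : cutHeight ω n M (i + 2) = t * n + n := by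
      have h3 : i + 2 = M * (t + 1) + (1 : ℕ) := by rw [hi, ← hc]; push_cast; ring
      rw [h3, cutHeight_of_not_dvd ω (hdvd _ _ (by simp) (by omega)), hdiv, hfl]
      push_cast; ring
    rw [show (M * (t + 1) : ℤ) = i + 1 by rw [hi, ← hc]; push_cast; ring] at hcut
    rw [hS2, hcut]
    have hQl : r = Q.length + 1 := by omega
    split_ifs with h3
    · rw [hval] at h3
      exact Or.inr ⟨by omega, Or.inl ⟨by simp [hQl, List.getD_eq_getElem?_getD], by omega⟩⟩
    · rw [hval] at h3
      exact Or.inl ⟨by simp [hQl, List.getD_eq_getElem?_getD], by omega⟩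

theorem cutHeight_eq (ω : ℤ → Fin 2) {n M j a s : ℤ} (hcop : IsCoprime M n)
    (h : j * n = M * a + s) (h0 : 0 ≤ s) (h1 : s < M) :
    (s = 0 → cutHeight ω n M j = a - (ω (j / M - 1)).val) ∧ (s ≠ 0 → cutHeight ω n M j = a) := by
  have ha := (ediv_emod_of_eq h h0 h1).1
  constructor
  · rintro rfl
    have hd : M ∣ j := hcop.dvd_of_dvd_mul_right ⟨a, by rw [h]; ring⟩
    simp [cutHeight, ha, hd]
  · intro hs
    rw [cutHeight_of_not_dvd, ha]
    rintro ⟨c, rfl⟩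
    have : M ∣ s := ⟨c * n - a, by linear_combination -h⟩
    exact hs (Int.eq_zero_of_dvd_of_nonneg_of_lt h0 h1 this)

theorem sub_emod_two_of_odd {n M j a s : ℤ} (hn : n % 2 = 1) (hM : M % 2 = 1)
    (h : j * n = M * a + s) : (j - a) % 2 = s % 2 := by
  obtain ⟨u, rfl⟩ : ∃ u, n = 2 * u + 1 := ⟨n / 2, by omega⟩
  obtain ⟨v, rfl⟩ : ∃ v, M = 2 * v + 1 := ⟨M / 2, by omega⟩
  have : j + 2 * (u * j) = a + 2 * (v * a) + s := by linear_combination h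
  omega

theorem IsCoprime.exists_mul_eq_mul_add {M n : ℤ} (h : IsCoprime M n) (s : ℤ) :
    ∃ j a, j * n = M * a + s := by
  obtain ⟨x, y, hxy⟩ := h
  exact ⟨s * y, -(s * x), by linear_combination s * hxy⟩

theorem CodedBy.biAb_eq_three_of_dvd {ω : ℤ → Fin 2} (hap : ¬ UltimatelyPeriodic ω)
    {W : ℤ → Fin 3} {n M : ℤ} (hn : n % 2 = 1) (hM : M % 2 = 1) (hM1 : 1 < M)
    (hW : CodedBy W (cutHeight ω n M)) {k : ℕ} (hk : 1 ≤ k) {q : ℤ} (hq : (k : ℤ) = M * q) :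
    biAb W k = 3 := by
  have hM0 : 0 < M := by omega
  have hq0 : 1 ≤ q := by by_contra!; nlinarith
  lift q to ℕ using by omega
  have hpar := sub_emod_two_of_odd hn hM (show (k : ℤ) * n = M * (q * n) + 0 by rw [hq]; ring)
  have hcut (t : ℤ) : cutHeight ω n M (M * t + k) - cutHeight ω n M (M * t) =
      q * n + (ω (t - 1)).val - (ω (t - 1 + q)).val := by
    rw [hq, ← mul_add, cutHeight_mul ω hM0, cutHeight_mul ω hM0,
      show t + q - 1 = t - 1 + q by ring]
    ring
  have hcut0 (t : ℤ) : (M * t - cutHeight ω n M (M * t)) % 2 = (ω (t - 1)).val := by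
    have h := sub_emod_two_of_odd hn hM (show M * t * n = M * (t * n) + 0 by ring)
    have := (ω (t - 1)).isLt
    rw [cutHeight_mul ω hM0]
    omega
  have hin (j : ℤ) (hj : ¬ M ∣ j) : cutHeight ω n M (j + k) - cutHeight ω n M j = q * n := by
    rw [cutHeight_of_not_dvd ω hj, cutHeight_of_not_dvd ω (by rwa [hq, Int.dvd_add_left ⟨_, rfl⟩]),
      hq, add_mul, mul_assoc, Int.add_mul_ediv_left _ _ hM0.ne']
    ring
  obtain ⟨⟨t₀, h00, h01⟩, t₁, h10, h11⟩ :=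
    exists_zero_one_of_not_ultimatelyPeriodic ω hap q (by omega)
  refine hW.biAb_eq_three k (k - q * n) (k - q * n + 1) (k - q * n - 1) (by omega) (by omega)
    (by omega) (fun j => ?_) ?_ ?_ ?_
  · by_cases hj : M ∣ j
    · obtain ⟨t, rfl⟩ := hj
      have := hcut t; have := hcut0 t
      have := (ω (t - 1)).isLt; have := (ω (t - 1 + q)).isLt
      omega
    · left
      rw [hin j hj]
      ring
  · refine ⟨1, ?_⟩
    rw [hin 1 fun h => hM1.ne' (Int.eq_one_of_dvd_one hM0.le h)]
    ring
  · refine ⟨M * (t₀ + 1), ?_⟩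
    have := hcut (t₀ + 1); have := hcut0 (t₀ + 1)
    simp only [add_sub_cancel_right] at *
    omega
  · refine ⟨M * (t₁ + 1), ?_⟩
    have := hcut (t₁ + 1); have := hcut0 (t₁ + 1)
    simp only [add_sub_cancel_right] at *
    omega

theorem CodedBy.biAb_eq_three_of_not_dvd {ω : ℤ → Fin 2} (hap : ¬ UltimatelyPeriodic ω)
    {W : ℤ → Fin 3} {n M : ℤ} (hn : n % 2 = 1) (hM : M % 2 = 1) (hM0 : 0 < M)
    (hcop : IsCoprime M n) (hW : CodedBy W (cutHeight ω n M)) {k : ℕ} (hk : ¬ M ∣ k) :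
    biAb W k = 3 := by
  obtain ⟨e, r, hkn, hr0, hrM⟩ : ∃ e r, (k : ℤ) * n = M * e + r ∧ 0 ≤ r ∧ r < M :=
    ⟨k * n / M, k * n % M, (Int.mul_ediv_add_emod _ _).symm, Int.emod_nonneg _ hM0.ne',
      Int.emod_lt_of_pos _ hM0⟩
  have hr : r ≠ 0 := fun h => hk (hcop.dvd_of_dvd_mul_right ⟨e, by rw [hkn, h]; ring⟩)
  have hpar := sub_emod_two_of_odd hn hM hkn
  have hleft (t : ℤ) : cutHeight ω n M (M * (t + 1) + k) - cutHeight ω n M (M * (t + 1)) =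
      e + (ω t).val ∧ (M * (t + 1) - cutHeight ω n M (M * (t + 1))) % 2 = (ω t).val := by
    have h := sub_emod_two_of_odd hn hM (show M * (t + 1) * n = M * ((t + 1) * n) + 0 by ring)
    have h' := (cutHeight_eq ω (j := M * (t + 1) + k) (a := (t + 1) * n + e) hcop
      (by linear_combination hkn) hr0 hrM).2 hr
    have := (ω t).isLt
    rw [h', cutHeight_mul ω hM0, add_sub_cancel_right]
    omega
  have hinc (j : ℤ) : cutHeight ω n M (j + k) - cutHeight ω n M j = e ∨
      cutHeight ω n M (j + k) - cutHeight ω n M j = e + 1 := by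
    obtain ⟨a, s, hj, hs0, hsM⟩ : ∃ a s, j * n = M * a + s ∧ 0 ≤ s ∧ s < M :=
      ⟨j * n / M, j * n % M, (Int.mul_ediv_add_emod _ _).symm, Int.emod_nonneg _ hM0.ne',
        Int.emod_lt_of_pos _ hM0⟩
    have h1 := cutHeight_eq ω hcop hj hs0 hsM
    have := (ω (j / M - 1)).isLt
    have := (ω ((j + k) / M - 1)).isLt
    by_cases hc : s + r < M
    · have h2 := cutHeight_eq ω (j := j + k) (a := a + e) (s := s + r) hcop
        (by linear_combination hj + hkn) (by omega) hc
      omega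
    · have h2 := cutHeight_eq ω (j := j + k) (a := a + e + 1) (s := s + r - M) hcop
        (by linear_combination hj + hkn) (by omega) (by omega)
      omega
  obtain ⟨⟨t₀, h₀, -⟩, t₁, h₁, -⟩ := exists_zero_one_of_not_ultimatelyPeriodic ω hap 1 le_rfl
  have hl₀ := hleft t₀
  have hl₁ := hleft t₁
  rcases Int.emod_two_eq_zero_or_one r with hre | hro
  · refine hW.biAb_eq_three k (k - e) (k - e - 1) (k - e - 1) (by omega) (by omega)
      (by omega) (fun j => ?_) ⟨M * (t₀ + 1), by omega⟩ ?_ ⟨M * (t₁ + 1), by omega⟩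
    · have := hinc j
      omega
    · obtain ⟨j, a, hj⟩ := hcop.exists_mul_eq_mul_add (M - 1)
      have := sub_emod_two_of_odd hn hM hj
      have h1 := (cutHeight_eq ω hcop hj (by omega) (by omega)).2 (by omega)
      have h2 := (cutHeight_eq ω (j := j + k) (a := a + e + 1) (s := r - 1) hcop
        (by linear_combination hj + hkn) (by omega) (by omega)).2 (by omega)
      exact ⟨j, by omega⟩
  · refine hW.biAb_eq_three k (k - e - 1) (k - e) (k - e) (by omega) (by omega)
      (by omega) (fun j => ?_) ⟨M * (t₁ + 1), by omega⟩ ⟨M * (t₀ + 1), by omega⟩ ?_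
    · have := hinc j
      omega
    · obtain ⟨j, a, hj⟩ := hcop.exists_mul_eq_mul_add 1
      have := sub_emod_two_of_odd hn hM hj
      have h1 := (cutHeight_eq ω hcop hj (by omega) (by omega)).2 (by omega)
      have h2 := (cutHeight_eq ω (j := j + k) (a := a + e) (s := r + 1) hcop
        (by linear_combination hj + hkn) (by omega) (by omega)).2 (by omega)
      exact ⟨j, by omega⟩

theorem stmt_18 (ω : ℤ → Fin 2) (hap : ¬ UltimatelyPeriodic ω)
    (m n : ℕ) (hm : 0 < m) (hn : 0 < n) (hcop : Nat.Coprime m n) (hme : Even m)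
    (Q : List (Fin 3)) (hpal : Q.Palindrome)
    (hQ : phi (christoffel m (m + n)) = 0 :: (Q ++ [2])) :
    ∀ k : ℕ, 1 ≤ k →
      biAb (biImage ω (fun a => if a = 0 then Q ++ [2, 0] else Q ++ [0, 2]) (m + n)) k ≤ 3 ∧
      (biAb (biImage ω (fun a => if a = 0 then Q ++ [2, 0] else Q ++ [0, 2]) (m + n)) k ≠ 1 →
        biAb (biImage ω (fun a => if a = 0 then Q ++ [2, 0] else Q ++ [0, 2]) (m + n)) k = 3) := by
  intro k hk
  have hW := codedBy_biImage ω m n hm hn hme Q hQ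
  have hm2 : m % 2 = 0 := Nat.even_iff.1 hme
  have hn2 : n % 2 = 1 := by
    by_contra h
    have := Nat.dvd_gcd (Nat.dvd_of_mod_eq_zero hm2) (Nat.dvd_of_mod_eq_zero (by omega : n % 2 = 0))
    rw [hcop.gcd_eq_one] at this
    omega
  have hcop' : IsCoprime (m + n : ℤ) n := by
    have := Nat.isCoprime_iff_coprime.2 hcop
    simpa using this.add_mul_right_left 1
  have h3 : biAb (biImage ω (fun a => if a = 0 then Q ++ [2, 0] else Q ++ [0, 2]) (m + n)) k = 3 := by
    by_cases hd : (m + n : ℤ) ∣ k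
    · obtain ⟨q, hq⟩ := hd
      exact hW.biAb_eq_three_of_dvd hap (by omega) (by omega) (by omega) hk hq
    · exact hW.biAb_eq_three_of_not_dvd hap (by omega) (by omega) (by omega) hcop' hd
  exact ⟨h3.le, fun _ => h3⟩
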